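/- arXiv:1602.06741 — 2 statements merged into one kernel-verified Lean document; each statement's English description precedes it below -/
import Mathlib

section
/- In a Radon plane, c_t(‖·‖) = 3/4 holds if and only if the unit circle is an affine regular hexagon. -/
open Module

variable {V : Type*} [NormedAddCommGroup V] [NormedSpace ℝ V]

noncomputable def sine {V : Type*} [NormedAddCommGroup V] [NormedSpace ℝ V] (x y : V) : ℝ :=
  ⨅ t : ℝ, ‖x + t • y‖

def BOrth {V : Type*} [NormedAddCommGroup V] [NormedSpace ℝ V] (x y : V) : Prop :=
  ∀ t : ℝ, ‖x‖ ≤ ‖x + t • y‖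

noncomputable def cD (V : Type*) [NormedAddCommGroup V] [NormedSpace ℝ V] : ℝ :=
  sInf {r : ℝ | ∃ x y : V, ‖x‖ = 1 ∧ ‖y‖ = 1 ∧ BOrth x y ∧ r = sine y x}

noncomputable def cR (V : Type*) [NormedAddCommGroup V] [NormedSpace ℝ V] : ℝ :=
  sSup {r : ℝ | ∃ x y : V, ‖x‖ = 1 ∧ ‖y‖ = 1 ∧ r = |sine x y - sine y x|}

def IsAffRegHexagon (V : Type*) [NormedAddCommGroup V] [NormedSpace ℝ V] : Prop :=
  ∃ u v : V, LinearIndependent ℝ ![u, v] ∧ ‖u‖ = 1 ∧ ‖v‖ = 1 ∧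
    {w : V | ‖w‖ = 1} =
      frontier (convexHull ℝ ({u, -u, v, -v, u + v, -(u + v)} : Set V))

noncomputable def triSines (V : Type*) [NormedAddCommGroup V] [NormedSpace ℝ V] : Set ℝ :=
  {r : ℝ | ∃ x y z : V, ‖x‖ = 1 ∧ ‖y‖ = 1 ∧ ‖z‖ = 1 ∧ x + y + z = 0 ∧ r = sine x y}

theorem sub_le_log_one_add {v : ℝ} (hv : |v| ≤ 1 / 2) : v - 2 * v ^ 2 ≤ Real.log (1 + v) := by
  obtain ⟨h₁, h₂⟩ := abs_le.mp hv
  have hpos : 0 < 1 + v := by linarith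
  refine le_trans ?_ (Real.one_sub_inv_le_log_of_pos hpos)
  have h : (1 + v) * (1 + v)⁻¹ = 1 := mul_inv_cancel₀ hpos.ne'
  have hinv : (1 + v)⁻¹ ≤ 2 := by
    rw [inv_le_comm₀ hpos two_pos]
    linarith
  have : 1 - (1 + v)⁻¹ = v - v ^ 2 * (1 + v)⁻¹ := by linear_combination (v - 1) * h
  nlinarith [sq_nonneg v]

/-- If two positive functions have a common bounded logarithmic subgradient on `[0, 1]`, then their
quotient does not decrease from `0` to `1`. -/
theorem log_sub_log_le_of_common_subgradient {M N k : ℝ → ℝ} {K : ℝ}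
    (hM : ∀ t ∈ Set.Icc (0 : ℝ) 1, 0 < M t) (hN : ∀ t ∈ Set.Icc (0 : ℝ) 1, 0 < N t)
    (hk : ∀ t ∈ Set.Icc (0 : ℝ) 1, |k t| ≤ K)
    (hMk : ∀ t ∈ Set.Icc (0 : ℝ) 1, ∀ s ∈ Set.Icc (0 : ℝ) 1, M t * (1 + k t * (s - t)) ≤ M s)
    (hNk : ∀ t ∈ Set.Icc (0 : ℝ) 1, ∀ s ∈ Set.Icc (0 : ℝ) 1, N t * (1 + k t * (s - t)) ≤ N s) :
    Real.log (M 0) - Real.log (N 0) ≤ Real.log (M 1) - Real.log (N 1) := by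
  have hK : 0 ≤ K := (abs_nonneg _).trans (hk 0 (by simp))
  have log_step : ∀ F : ℝ → ℝ, (∀ t ∈ Set.Icc (0 : ℝ) 1, 0 < F t) →
      (∀ t ∈ Set.Icc (0 : ℝ) 1, ∀ s ∈ Set.Icc (0 : ℝ) 1, F t * (1 + k t * (s - t)) ≤ F s) →
      ∀ t ∈ Set.Icc (0 : ℝ) 1, ∀ s ∈ Set.Icc (0 : ℝ) 1, K * |s - t| ≤ 1 / 2 →
      Real.log (F t) + k t * (s - t) - 2 * (K * |s - t|) ^ 2 ≤ Real.log (F s) := by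
    intro F hF hFk t ht s hs hst
    have habs : |k t * (s - t)| ≤ K * |s - t| := by
      rw [abs_mul]
      exact mul_le_mul_of_nonneg_right (hk t ht) (abs_nonneg _)
    have hlog := sub_le_log_one_add (habs.trans hst)
    have hpos : 0 < 1 + k t * (s - t) := by linarith [(abs_le.mp (habs.trans hst)).1]
    have hle := Real.log_le_log (mul_pos (hF t ht) hpos) (hFk t ht s hs)
    rw [Real.log_mul (hF t ht).ne' hpos.ne'] at hle
    have hsq : (k t * (s - t)) ^ 2 ≤ (K * |s - t|) ^ 2 := by
      rw [← sq_abs (k t * (s - t))]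
      exact pow_le_pow_left₀ (abs_nonneg _) habs 2
    linarith
  have partition : ∀ n : ℕ, 0 < n → 2 * K ≤ n →
      Real.log (M 0) - Real.log (N 0) - (2 * K + 4 * K ^ 2) / n
        ≤ Real.log (M 1) - Real.log (N 1) := by
    intro n hn hKn
    have hn' : (0 : ℝ) < n := by exact_mod_cast hn
    have hmem : ∀ i : ℕ, i ≤ n → (i / n : ℝ) ∈ Set.Icc (0 : ℝ) 1 := by
      intro i hi
      have hi' : (i : ℝ) ≤ n := by exact_mod_cast hi
      exact ⟨by positivity, (div_le_one hn').mpr hi'⟩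
    have telescope : ∀ i : ℕ, i ≤ n →
        Real.log (M 0) - Real.log (N 0) + (k 0 - k (i / n)) / n - 4 * (K / n) ^ 2 * i
          ≤ Real.log (M (i / n)) - Real.log (N (i / n)) := by
      intro i
      induction i with
      | zero => intro _; simp
      | succ i ih =>
        intro hi
        have ih := ih (by omega)
        have hd : ((i + 1 : ℕ) / n : ℝ) - i / n = 1 / n := by push_cast; ring
        have hd' : (i / n : ℝ) - (i + 1 : ℕ) / n = -(1 / n) := by push_cast; ring
        have habs : |((i + 1 : ℕ) / n : ℝ) - i / n| = 1 / n := by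
          rw [hd, abs_of_pos (by positivity)]
        have hsmall : K * (1 / n) ≤ 1 / 2 := by
          rw [mul_one_div, div_le_iff₀ hn']
          linarith
        have h₁ := log_step M hM hMk _ (hmem i (by omega)) _ (hmem (i + 1) hi)
          (by rw [habs]; exact hsmall)
        have h₂ := log_step N hN hNk _ (hmem (i + 1) hi) _ (hmem i (by omega))
          (by rw [abs_sub_comm, habs]; exact hsmall)
        rw [habs, hd] at h₁
        rw [abs_sub_comm, habs, hd'] at h₂
        generalize ((i + 1 : ℕ) / n : ℝ) = b at *
        push_cast
        ring_nf at ih h₁ h₂ ⊢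
        linarith
    have h := telescope n le_rfl
    rw [div_self hn'.ne'] at h
    have hk₀ := (abs_le.mp (hk 0 (by simp))).1
    have hk₁ := (abs_le.mp (hk 1 (by simp))).2
    have hdiv : -(2 * K) / n ≤ (k 0 - k 1) / n := by gcongr; linarith
    have hsq : 4 * (K / n) ^ 2 * n = 4 * K ^ 2 / n := by field_simp
    rw [hsq] at h
    rw [add_div]
    rw [neg_div] at hdiv
    linarith
  have hlim : Filter.Tendsto
      (fun n : ℕ => Real.log (M 0) - Real.log (N 0) - (2 * K + 4 * K ^ 2) / n) Filter.atTop
      (nhds (Real.log (M 0) - Real.log (N 0) - 0)) :=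
    tendsto_const_nhds.sub (tendsto_const_div_atTop_nhds_zero_nat _)
  rw [sub_zero] at hlim
  obtain ⟨n₀, hn₀⟩ := exists_nat_ge (2 * K)
  refine le_of_tendsto hlim ?_
  filter_upwards [Filter.eventually_gt_atTop 0, Filter.eventually_ge_atTop n₀] with n hn hn'
  exact partition n hn (hn₀.trans (by exact_mod_cast hn'))

/-- A nonzero alternating bilinear form on a plane. -/
structure IsAreaForm (ω : V →L[ℝ] V →L[ℝ] ℝ) : Prop where
  antisymm : ∀ x y, ω x y = -ω y x
  plucker : ∀ x y z, ω x y • z + ω y z • x + ω z x • y = 0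
  surjective : ∀ f : V →L[ℝ] ℝ, ∃ w, ∀ v, ω v w = f v

/-- An area form under which the norm of the plane coincides with its antinorm. -/
structure IsRadonForm (ω : V →L[ℝ] V →L[ℝ] ℝ) : Prop where
  antisymm : ∀ x y, ω x y = -ω y x
  plucker : ∀ x y z, ω x y • z + ω y z • x + ω z x • y = 0
  abs_le : ∀ x y, |ω x y| ≤ ‖x‖ * ‖y‖
  exists_norming : ∀ x, x ≠ 0 → ∃ w, ‖w‖ = 1 ∧ ω x w = ‖x‖

theorem exists_isAreaForm (hV : finrank ℝ V = 2) :
    ∃ ω : V →L[ℝ] V →L[ℝ] ℝ, IsAreaForm ω := by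
  have : FiniteDimensional ℝ V := Module.finite_of_finrank_eq_succ hV
  let b := finBasisOfFinrankEq ℝ V hV
  let f : Fin 2 → V →L[ℝ] ℝ := fun i => (b.coord i).toContinuousLinearMap
  have hf : ∀ i v, f i v = b.repr v i := fun i v => rfl
  refine ⟨(f 0).smulRight (f 1) - (f 1).smulRight (f 0), ?_, ?_, ?_⟩
  · intro x y
    simp
    ring
  · intro x y z
    apply b.ext_elem
    intro i
    fin_cases i <;> simp [hf] <;> ring
  · intro g
    refine ⟨g (b 0) • b 1 - g (b 1) • b 0, fun v => ?_⟩
    have hv := congrArg g (b.sum_repr v)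
    rw [Fin.sum_univ_two, map_add, map_smul, map_smul, smul_eq_mul, smul_eq_mul] at hv
    simp [hf, ← hv]

namespace IsAreaForm

variable {ω : V →L[ℝ] V →L[ℝ] ℝ}

theorem self_eq_zero (hω : IsAreaForm ω) (x : V) : ω x x = 0 := by
  linarith [hω.antisymm x x]

/-- In a Radon plane, the norm and the antinorm have a common logarithmic subgradient. -/
theorem exists_common_subgradient (hω : IsAreaForm ω)
    (hRadon : ∀ x y : V, BOrth x y → BOrth y x) {x : V} (hx : x ≠ 0) :
    0 < ‖ω x‖ ∧ ∃ f : V →L[ℝ] ℝ, (∀ v, |f v| ≤ ‖v‖ / ‖x‖) ∧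
      (∀ v, ‖x‖ * (1 + f (v - x)) ≤ ‖v‖) ∧ ∀ v, ‖ω x‖ * (1 + f (v - x)) ≤ ‖ω v‖ := by
  have hx' : 0 < ‖x‖ := norm_pos_iff.mpr hx
  obtain ⟨g, hg, hgx⟩ := exists_dual_vector ℝ x hx'.ne'
  simp only [RCLike.ofReal_real_eq_id, id] at hgx
  obtain ⟨w, hw⟩ := hω.surjective g
  have hgle : ∀ v, |g v| ≤ ‖v‖ := fun v => by simpa [hg] using g.le_opNorm v
  have hxw : BOrth x w := fun t => by
    have h := (le_abs_self _).trans (hgle (x + t • w))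
    rwa [← hw, map_add, map_smul, add_apply, smul_apply,
      hω.self_eq_zero, smul_zero, add_zero, hw, hgx] at h
  have hwx := hRadon x w hxw
  have hw₀ : 0 < ‖w‖ := by
    refine norm_pos_iff.mpr fun h => hx'.ne' ?_
    rw [← hgx, ← hw, h, map_zero]
  have hgw : g w = 0 := by rw [← hw, hω.self_eq_zero]
  have antinorm_le : ‖ω x‖ ≤ ‖x‖ / ‖w‖ := by
    refine ContinuousLinearMap.opNorm_le_bound _ (by positivity) fun v => ?_
    have hp := hω.plucker x w v
    rcases eq_or_ne (ω x v) 0 with h | h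
    · rw [h]
      simp only [norm_zero]
      positivity
    · have hv : v = (ω x v / ‖x‖) • (w + (-(ω w v) / ω x v) • x) := by
        have hxw' : ω x w = ‖x‖ := by rw [hw, hgx]
        rw [hxw', hω.antisymm v x] at hp
        have e : (ω x v / ‖x‖) * (-(ω w v) / ω x v) = -(ω w v) / ‖x‖ := by field_simp
        rw [smul_add, smul_smul, e]
        have : ‖x‖ • v = ω x v • w - ω w v • x := by
          rw [← sub_eq_zero, ← hp]
          module
        apply smul_right_injective V hx'.ne'
        simp only
        rw [this, smul_add, smul_smul, smul_smul, mul_div_cancel₀ _ hx'.ne',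
          mul_div_cancel₀ _ hx'.ne']
        module
      have hnorm : ‖v‖ = |ω x v| / ‖x‖ * ‖w + (-(ω w v) / ω x v) • x‖ := by
        conv_lhs => rw [hv]
        rw [norm_smul, Real.norm_eq_abs, abs_div, abs_of_pos hx']
      have hge : |ω x v| / ‖x‖ * ‖w‖ ≤ ‖v‖ := by
        rw [hnorm]
        exact mul_le_mul_of_nonneg_left (hwx _) (by positivity)
      rw [Real.norm_eq_abs]
      calc |ω x v| = ‖x‖ / ‖w‖ * (|ω x v| / ‖x‖ * ‖w‖) := by field_simp
        _ ≤ ‖x‖ / ‖w‖ * ‖v‖ := by gcongr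
  have le_antinorm : ∀ v, |g v| ≤ ‖ω v‖ * ‖w‖ := fun v => by
    rw [← hw, ← Real.norm_eq_abs]
    exact (ω v).le_opNorm w
  have antinorm_eq : ‖ω x‖ = ‖x‖ / ‖w‖ := by
    refine antinorm_le.antisymm ?_
    rw [div_le_iff₀ hw₀]
    exact (by rw [hgx] : ‖x‖ ≤ g x).trans ((le_abs_self _).trans (le_antinorm x))
  have value : ∀ v, ‖x‖ * (1 + (‖x‖⁻¹ • g) (v - x)) = g v := fun v => by
    rw [smul_apply, map_sub, hgx, smul_eq_mul]
    field_simp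
    ring
  refine ⟨by rw [antinorm_eq]; positivity, ‖x‖⁻¹ • g, fun v => ?_, fun v => ?_, fun v => ?_⟩
  · rw [smul_apply, smul_eq_mul, abs_mul, abs_of_pos (inv_pos.mpr hx'),
      inv_mul_eq_div]
    gcongr
    exact hgle v
  · rw [value]
    exact (le_abs_self _).trans (hgle v)
  · rw [antinorm_eq, div_mul_eq_mul_div, value, div_le_iff₀ hw₀]
    exact (le_abs_self _).trans (le_antinorm v)

theorem antinorm_mul_norm_eq (hω : IsAreaForm ω)
    (hRadon : ∀ x y : V, BOrth x y → BOrth y x) {x y : V} (hxy : ω x y ≠ 0) :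
    ‖ω x‖ * ‖y‖ = ‖ω y‖ * ‖x‖ := by
  have hx : x ≠ 0 := by rintro rfl; simp at hxy
  have hy : y ≠ 0 := by rintro rfl; simp at hxy
  set γ : ℝ → V := fun t => x + t • (y - x) with hγ
  have hγ₀ : ∀ t, γ t ≠ 0 := by
    intro t h
    have h₁ : ω (γ t) y = (1 - t) * ω x y := by
      simp [hγ, hω.self_eq_zero]
      ring
    rw [h, map_zero, zero_apply] at h₁
    rcases mul_eq_zero.mp h₁.symm with h₂ | h₂
    · have ht : t = 1 := by linarith
      simp [hγ, ht] at h
      exact hy h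
    · exact hxy h₂
  have hcont : Continuous γ := by fun_prop
  obtain ⟨t₀, -, hmin⟩ := isCompact_Icc.exists_isMinOn (Set.nonempty_Icc.mpr zero_le_one)
    (hcont.norm.continuousOn (s := Set.Icc (0 : ℝ) 1))
  have hm : 0 < ‖γ t₀‖ := norm_pos_iff.mpr (hγ₀ t₀)
  choose hpos f hf hN hM using fun t => hω.exists_common_subgradient hRadon (hγ₀ t)
  have hdiff : ∀ t s, γ s - γ t = (s - t) • (y - x) := fun t s => by
    simp only [hγ]
    module
  have hk : ∀ t ∈ Set.Icc (0 : ℝ) 1, |f t (y - x)| ≤ ‖y - x‖ / ‖γ t₀‖ := fun t ht =>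
    (hf t _).trans (div_le_div_of_nonneg_left (norm_nonneg _) hm (hmin ht))
  have hslope : ∀ t s, f t (γ s - γ t) = f t (y - x) * (s - t) := fun t s => by
    rw [hdiff, map_smul, smul_eq_mul, mul_comm]
  have hN' : ∀ t ∈ Set.Icc (0 : ℝ) 1, ∀ s ∈ Set.Icc (0 : ℝ) 1,
      ‖γ t‖ * (1 + f t (y - x) * (s - t)) ≤ ‖γ s‖ := fun t _ s _ => by
    rw [← hslope]; exact hN t _
  have hM' : ∀ t ∈ Set.Icc (0 : ℝ) 1, ∀ s ∈ Set.Icc (0 : ℝ) 1,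
      ‖ω (γ t)‖ * (1 + f t (y - x) * (s - t)) ≤ ‖ω (γ s)‖ := fun t _ s _ => by
    rw [← hslope]; exact hM t _
  have hNpos : ∀ t ∈ Set.Icc (0 : ℝ) 1, 0 < ‖γ t‖ := fun t _ => norm_pos_iff.mpr (hγ₀ t)
  have hMpos : ∀ t ∈ Set.Icc (0 : ℝ) 1, 0 < ‖ω (γ t)‖ := fun t _ => hpos t
  have h₁ := log_sub_log_le_of_common_subgradient (M := fun t => ‖ω (γ t)‖)
    (N := fun t => ‖γ t‖) (k := fun t => f t (y - x)) hMpos hNpos hk hM' hN'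
  have h₂ := log_sub_log_le_of_common_subgradient (M := fun t => ‖γ t‖)
    (N := fun t => ‖ω (γ t)‖) (k := fun t => f t (y - x)) hNpos hMpos hk hN' hM'
  have hγ0 : γ 0 = x := by simp [hγ]
  have hγ1 : γ 1 = y := by simp [hγ]
  simp only [hγ0, hγ1] at h₁ h₂
  have hx' := norm_pos_iff.mpr hx
  have hy' := norm_pos_iff.mpr hy
  have hωx : 0 < ‖ω x‖ := hγ0 ▸ hpos 0
  have hωy : 0 < ‖ω y‖ := hγ1 ▸ hpos 1
  apply Real.log_injOn_pos (Set.mem_Ioi.mpr (by positivity)) (Set.mem_Ioi.mpr (by positivity))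
  rw [Real.log_mul hωx.ne' hy'.ne', Real.log_mul hωy.ne' hx'.ne']
  linarith

theorem exists_antinorm_eq_const_mul_norm [Nontrivial V] (hω : IsAreaForm ω)
    (hRadon : ∀ x y : V, BOrth x y → BOrth y x) : ∃ c > 0, ∀ x, ‖ω x‖ = c * ‖x‖ := by
  obtain ⟨a, ha⟩ := exists_ne (0 : V)
  have ha' := norm_pos_iff.mpr ha
  have hωa := (hω.exists_common_subgradient hRadon ha).1
  refine ⟨‖ω a‖ / ‖a‖, by positivity, fun x => ?_⟩
  by_cases hax : ω a x = 0
  · obtain ⟨g, -, hga⟩ := exists_dual_vector ℝ a ha'.ne'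
    obtain ⟨w, hw⟩ := hω.surjective g
    have hp := hω.plucker a w x
    rw [hω.antisymm x a, hax, hw, hga] at hp
    simp only [RCLike.ofReal_real_eq_id, id, neg_zero, zero_smul, add_zero] at hp
    have hx : x = (-(ω w x) / ‖a‖) • a := by
      apply smul_right_injective V ha'.ne'
      simp only
      rw [smul_smul, mul_div_cancel₀ _ ha'.ne', neg_smul]
      exact eq_neg_of_add_eq_zero_left hp
    rw [hx, map_smul, norm_smul, norm_smul]
    field_simp
  · rw [div_mul_eq_mul_div, eq_div_iff ha'.ne']
    exact (hω.antinorm_mul_norm_eq hRadon hax).symm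

end IsAreaForm

theorem exists_isRadonForm (hV : finrank ℝ V = 2)
    (hRadon : ∀ x y : V, BOrth x y → BOrth y x) : ∃ ω : V →L[ℝ] V →L[ℝ] ℝ, IsRadonForm ω := by
  have : Nontrivial V := Module.nontrivial_of_finrank_eq_succ hV
  obtain ⟨ω, hω⟩ := exists_isAreaForm hV
  obtain ⟨c, hc, hωc⟩ := hω.exists_antinorm_eq_const_mul_norm hRadon
  refine ⟨c⁻¹ • ω, ?_, ?_, ?_, ?_⟩
  · intro x y
    simp [hω.antisymm x y]
  · intro x y z
    simp only [smul_apply, smul_assoc, ← smul_add, hω.plucker, smul_zero]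
  · intro x y
    have h := (ω x).le_opNorm y
    rw [hωc, Real.norm_eq_abs] at h
    rw [smul_apply, smul_apply, smul_eq_mul, abs_mul,
      abs_of_pos (inv_pos.mpr hc), inv_mul_le_iff₀ hc]
    linarith
  · intro x hx
    have hx' := norm_pos_iff.mpr hx
    obtain ⟨g, hg, hgx⟩ := exists_dual_vector ℝ x hx'.ne'
    obtain ⟨w, hw⟩ := hω.surjective g
    have hgw : ‖w‖ * c = 1 := by
      have hneg : ω w = -g := by
        ext v
        rw [hω.antisymm, hw, neg_apply]
      rw [mul_comm, ← hωc, hneg, norm_neg, hg]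
    refine ⟨c • w, ?_, ?_⟩
    · rw [norm_smul, Real.norm_of_nonneg hc.le, mul_comm, hgw]
    · simp only [smul_apply, map_smul, smul_eq_mul, hw, hgx]
      simp [hc.ne']

theorem norm_add_of_add_add_eq_zero {E : Type*} [NormedAddCommGroup E] {x y z : E}
    (h : x + y + z = 0) : ‖x + y‖ = ‖z‖ := by
  rw [eq_neg_of_add_eq_zero_left h, norm_neg]

/-- The arithmetic behind the bound `3 / 4`: cyclic products `p * (1 - q)` cannot all exceed
`1 / 4`, and they all reach `1 / 4` only at the midpoint. -/
theorem cyclic_mul_one_sub {p q r d : ℝ} (hp : p ∈ Set.Icc (0 : ℝ) 1)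
    (hq : q ∈ Set.Icc (0 : ℝ) 1) (hr : r ∈ Set.Icc (0 : ℝ) 1) (h₁ : d ≤ p * (1 - q))
    (h₂ : d ≤ q * (1 - r)) (h₃ : d ≤ r * (1 - p)) :
    d ≤ 1 / 4 ∧ (d = 1 / 4 → p = 1 / 2 ∧ q = 1 / 2 ∧ r = 1 / 2) := by
  obtain ⟨hp₀, hp₁⟩ := hp
  obtain ⟨hq₀, hq₁⟩ := hq
  obtain ⟨hr₀, hr₁⟩ := hr
  have amgm : ∀ {a b : ℝ}, 0 ≤ a → b ≤ 1 → 1 / 4 ≤ a * (1 - b) → b ≤ a := by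
    intro a b ha hb h
    nlinarith [sq_nonneg (a - (1 - b))]
  constructor
  · by_contra! hd
    have e₁ := amgm hp₀ hq₁ (by linarith)
    have e₂ := amgm hq₀ hr₁ (by linarith)
    have e₃ := amgm hr₀ hp₁ (by linarith)
    have : p = q := by linarith
    subst this
    nlinarith [sq_nonneg (p - 1 / 2)]
  · rintro rfl
    have e₁ := amgm hp₀ hq₁ h₁
    have e₂ := amgm hq₀ hr₁ h₂
    have e₃ := amgm hr₀ hp₁ h₃
    have e : p = q := by linarith
    have e' : r = q := by linarith
    subst e e'
    have : r = 1 / 2 := by nlinarith [sq_nonneg (r - 1 / 2)]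
    exact ⟨this, this, this⟩

namespace IsRadonForm

variable {ω : V →L[ℝ] V →L[ℝ] ℝ}

theorem self_eq_zero (hω : IsRadonForm ω) (x : V) : ω x x = 0 := by
  linarith [hω.antisymm x x]

theorem plucker_apply (hω : IsRadonForm ω) (a b c d : V) :
    ω a b * ω c d + ω b c * ω a d + ω c a * ω b d = 0 := by
  simpa using congrArg (fun v => ω v d) (hω.plucker a b c)

theorem sine_eq_abs (hω : IsRadonForm ω) (x : V) {y : V} (hy : ‖y‖ = 1) :
    sine x y = |ω x y| := by
  have hlower : ∀ t : ℝ, |ω x y| ≤ ‖x + t • y‖ := fun t => by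
    have h := hω.abs_le (x + t • y) y
    simpa [hω.self_eq_zero, hy] using h
  refine le_antisymm ?_ (le_ciInf hlower)
  obtain ⟨w, hw, hyw⟩ := hω.exists_norming y (norm_ne_zero_iff.mp (by simp [hy]))
  rw [hy] at hyw
  refine (ciInf_le ⟨|ω x y|, Set.forall_mem_range.mpr hlower⟩ (-ω x w)).trans_eq ?_
  have hp := hω.plucker y w x
  rw [hyw, hω.antisymm w x, one_smul] at hp
  have : x + (-ω x w) • y = ω x y • -w := by
    rw [← sub_eq_zero, ← hp]
    module
  rw [this, norm_smul, norm_neg, hw, mul_one, Real.norm_eq_abs]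

/-- For a vertex `x` of an equilateral triangle, a functional supporting the unit ball at `x`. -/
theorem exists_support_of_triangle (hω : IsRadonForm ω) {x y z : V} (hx : ‖x‖ = 1)
    (hy : ‖y‖ = 1) (hz : ‖z‖ = 1) (h : x + y + z = 0) :
    ∃ w, ∃ p ∈ Set.Icc (0 : ℝ) 1, ‖w‖ = 1 ∧ ω x w = 1 ∧ ω y w = -p ∧ ω z w = -(1 - p) := by
  obtain ⟨w, hw, hxw⟩ := hω.exists_norming x (norm_ne_zero_iff.mp (by simp [hx]))
  have hsum : ω x w + ω y w + ω z w = 0 := by simpa using congrArg (fun v => ω v w) h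
  have hyw := hω.abs_le y w
  have hzw := hω.abs_le z w
  rw [hx] at hxw
  rw [hy, hw, one_mul, abs_le'] at hyw
  rw [hz, hw, one_mul, abs_le'] at hzw
  exact ⟨w, -ω y w, ⟨by linarith, by linarith⟩, hw, hxw, by ring, by linarith⟩

theorem triangle_bound_of_nonneg (hω : IsRadonForm ω) {x y z : V} (hx : ‖x‖ = 1)
    (hy : ‖y‖ = 1) (hz : ‖z‖ = 1) (h : x + y + z = 0) (hs : 0 ≤ ω x y) :
    3 / 4 ≤ ω x y ∧ (ω x y = 3 / 4 →
      ∃ u v : V, ‖u‖ = 1 ∧ ‖v‖ = 1 ∧ ‖u + v‖ = 1 ∧ ω u v = 1) := by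
  obtain ⟨u, p, hp, hu, hxu, hyu, hzu⟩ := hω.exists_support_of_triangle hx hy hz h
  obtain ⟨v, q, hq, hv, hyv, hzv, hxv⟩ := hω.exists_support_of_triangle hy hz hx
    (by rw [← h]; abel)
  obtain ⟨w, r, hr, hw, hzw, hxw, hyw⟩ := hω.exists_support_of_triangle hz hx hy
    (by rw [← h]; abel)
  have hz' : z = -(x + y) := eq_neg_of_add_eq_zero_right h
  have hyz : ω y z = ω x y := by
    rw [hz', map_neg, map_add, hω.self_eq_zero, hω.antisymm y x]; ring
  have hzx : ω z x = ω x y := by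
    rw [hω.antisymm z x, hz', map_neg, map_add, hω.self_eq_zero]; ring
  have product : ∀ {a b a' b' : V} {p' q' : ℝ}, ω a a' = 1 → ω b b' = 1 → ω b a' = -p' →
      ω a b' = -(1 - q') → ω a b * ω a' b' = 1 - p' * (1 - q') := by
    intro a b a' b' p' q' haa hbb hba hab
    have hpl := hω.plucker_apply a b a' b'
    rw [hbb, hba, hab, hω.antisymm a' a, haa] at hpl
    linarith
  have bound : ∀ {a' b' : V}, ‖a'‖ = 1 → ‖b'‖ = 1 → ω x y * ω a' b' ≤ ω x y := by
    intro a' b' ha hb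
    have hle := (le_abs_self _).trans (hω.abs_le a' b')
    rw [ha, hb] at hle
    nlinarith
  have huv := product hxu hyv hyu hxv
  have hvw := product hyv hzw hzv hyw
  have hwu := product hzw hxu hxw hzu
  rw [hyz] at hvw
  rw [hzx] at hwu
  have b₁ := bound hu hv
  have b₂ := bound hv hw
  have b₃ := bound hw hu
  obtain ⟨hle, heq⟩ := cyclic_mul_one_sub (d := 1 - ω x y) hp hq hr (by linarith) (by linarith)
    (by linarith)
  refine ⟨by linarith, fun hs' => ?_⟩
  obtain ⟨rfl, rfl, rfl⟩ := heq (by linarith)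
  refine ⟨u, v, hu, hv, ?_, by rw [hs'] at huv; linarith⟩
  have hsum : u + v + w = 0 := by
    have hpl := hω.plucker x y (u + v + w)
    have e₁ : ω y (u + v + w) = 0 := by
      rw [map_add, map_add, hyu, hyv, hyw]; norm_num
    have e₂ : ω (u + v + w) x = 0 := by
      rw [hω.antisymm, map_add, map_add, hxu, hxv, hxw]; norm_num
    rw [e₁, e₂, zero_smul, zero_smul, add_zero, add_zero, hs'] at hpl
    exact (smul_eq_zero.mp hpl).resolve_left (by norm_num)
  exact (norm_add_of_add_add_eq_zero hsum).trans hw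

theorem triangle_bound (hω : IsRadonForm ω) {x y z : V} (hx : ‖x‖ = 1)
    (hy : ‖y‖ = 1) (hz : ‖z‖ = 1) (h : x + y + z = 0) :
    3 / 4 ≤ sine x y ∧ (sine x y = 3 / 4 →
      ∃ u v : V, ‖u‖ = 1 ∧ ‖v‖ = 1 ∧ ‖u + v‖ = 1 ∧ ω u v = 1) := by
  rw [hω.sine_eq_abs x hy]
  rcases le_total 0 (ω x y) with hs | hs
  · rw [abs_of_nonneg hs]
    exact hω.triangle_bound_of_nonneg hx hy hz h hs
  · rw [abs_of_nonpos hs, ← hω.antisymm y x]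
    exact hω.triangle_bound_of_nonneg hy hx hz (by rw [← h]; abel)
      (by rw [hω.antisymm]; linarith)

theorem eq_add_of_apply_eq_one (hω : IsRadonForm ω) {u v : V} (huv : ω u v = 1) (w : V) :
    w = ω w v • u + ω u w • v := by
  have hp := hω.plucker u v w
  rw [huv, one_smul, hω.antisymm v w, hω.antisymm w u] at hp
  rw [← sub_eq_zero, ← hp]
  module

theorem isAffRegHexagon_of_apply_eq_one (hω : IsRadonForm ω) {u v : V} (hu : ‖u‖ = 1)
    (hv : ‖v‖ = 1) (hadd : ‖u + v‖ = 1) (huv : ω u v = 1) : IsAffRegHexagon V := by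
  have : Nontrivial V := ⟨u, 0, norm_ne_zero_iff.mp (by simp [hu])⟩
  refine ⟨u, v, ?_, hu, hv, ?_⟩
  · rw [LinearIndependent.pair_iff]
    intro s t hst
    have h₁ : ω (s • u + t • v) v = 0 := by rw [hst]; simp
    have h₂ : ω u (s • u + t • v) = 0 := by rw [hst]; simp
    simp [huv, hω.self_eq_zero] at h₁ h₂
    exact ⟨h₁, h₂⟩
  set S : Set V := {u, -u, v, -v, u + v, -(u + v)} with hS
  have mem : ∀ w ∈ S, w ∈ convexHull ℝ S := fun w hw => subset_convexHull ℝ S hw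
  have hconv := convex_convexHull ℝ S
  have hull₀ : (0 : V) ∈ convexHull ℝ S := by
    have h := hconv.add_smul_mem (mem u (by simp [hS])) (y := -u + -u)
      (by simpa using mem (-u) (by simp [hS])) (t := 1 / 2) ⟨by norm_num, by norm_num⟩
    convert h using 1
    module
  have combo : ∀ {a b : V} {s t : ℝ}, a ∈ S → b ∈ S → 0 ≤ s → 0 ≤ t → s + t ≤ 1 →
      s • a + t • b ∈ convexHull ℝ S := by
    intro a b s t ha hb hs ht hst
    rcases eq_or_lt_of_le (add_nonneg hs ht) with h | h
    · have hs₀ : s = 0 := by linarith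
      have ht₀ : t = 0 := by linarith
      simpa [hs₀, ht₀] using hull₀
    · have hmem := hconv (mem a ha) (mem b hb) (div_nonneg hs h.le) (div_nonneg ht h.le)
        (by field_simp)
      have hmem' := (hconv.starConvex hull₀).smul_mem hmem h.le hst
      rwa [smul_add, smul_smul, smul_smul, mul_div_cancel₀ _ h.ne',
        mul_div_cancel₀ _ h.ne'] at hmem'
  have hhull : convexHull ℝ S = Metric.closedBall 0 1 := by
    apply subset_antisymm
    · refine convexHull_min ?_ (convex_closedBall 0 1)
      rintro w (rfl | rfl | rfl | rfl | rfl | rfl) <;>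
        simp only [mem_closedBall_zero_iff, norm_neg, hu, hv, hadd, le_refl]
    · intro w hw
      rw [mem_closedBall_zero_iff] at hw
      have ha := hω.abs_le w v
      have hb := hω.abs_le u w
      have hab := hω.abs_le w (u + v)
      rw [map_add, hω.antisymm w u] at hab
      rw [hv, mul_one] at ha
      rw [hu, one_mul] at hb
      rw [hadd, mul_one] at hab
      have hw' := hω.eq_add_of_apply_eq_one huv w
      obtain ⟨ha₁, ha₂⟩ := _root_.abs_le.mp (ha.trans hw)
      obtain ⟨hb₁, hb₂⟩ := _root_.abs_le.mp (hb.trans hw)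
      obtain ⟨hab₁, hab₂⟩ := _root_.abs_le.mp (hab.trans hw)
      generalize ω w v = a at *
      generalize ω u w = b at *
      rw [hw']
      have hull_of_eq : ∀ {c d : V} {s t : ℝ}, c ∈ S → d ∈ S → 0 ≤ s → 0 ≤ t → s + t ≤ 1 →
          a • u + b • v = s • c + t • d → a • u + b • v ∈ convexHull ℝ S :=
        fun hc hd hs ht hst e => e ▸ combo hc hd hs ht hst
      rcases le_total 0 a with h₁ | h₁ <;> rcases le_total 0 b with h₂ | h₂
      · rcases le_total a b with h₃ | h₃
        · exact hull_of_eq (c := v) (d := u + v) (s := b - a) (t := a) (by simp [hS])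
            (by simp [hS]) (by linarith) h₁ (by linarith) (by module)
        · exact hull_of_eq (c := u) (d := u + v) (s := a - b) (t := b) (by simp [hS])
            (by simp [hS]) (by linarith) h₂ (by linarith) (by module)
      · exact hull_of_eq (c := u) (d := -v) (s := a) (t := -b) (by simp [hS])
          (by simp [hS]) h₁ (by linarith) (by linarith) (by module)
      · exact hull_of_eq (c := -u) (d := v) (s := -a) (t := b) (by simp [hS])
          (by simp [hS]) (by linarith) h₂ (by linarith) (by module)
      · rcases le_total a b with h₃ | h₃
        · exact hull_of_eq (c := -u) (d := -(u + v)) (s := b - a) (t := -b) (by simp [hS])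
            (by simp [hS]) (by linarith) (by linarith) (by linarith) (by module)
        · exact hull_of_eq (c := -v) (d := -(u + v)) (s := a - b) (t := -a) (by simp [hS])
            (by simp [hS]) (by linarith) (by linarith) (by linarith) (by module)
  rw [hhull, frontier_closedBall _ one_ne_zero]
  ext w
  simp

theorem isCompact_triSines [FiniteDimensional ℝ V] (hω : IsRadonForm ω) :
    IsCompact (triSines V) := by
  have himage : triSines V = (fun p : V × V => |ω p.1 p.2|) ''
      ((Metric.sphere 0 1 ×ˢ Metric.sphere 0 1) ∩ {p : V × V | ‖p.1 + p.2‖ = 1}) := by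
    ext r
    constructor
    · rintro ⟨x, y, z, hx, hy, hz, h, rfl⟩
      exact ⟨(x, y), ⟨⟨by simpa using hx, by simpa using hy⟩, (norm_add_of_add_add_eq_zero h).trans hz⟩,
        (hω.sine_eq_abs x hy).symm⟩
    · rintro ⟨⟨x, y⟩, ⟨⟨hx, hy⟩, hxy⟩, rfl⟩
      simp only [mem_sphere_zero_iff_norm] at hx hy
      exact ⟨x, y, -(x + y), hx, hy, by rw [norm_neg]; exact hxy, by abel,
        (hω.sine_eq_abs x hy).symm⟩
  have : ProperSpace V := FiniteDimensional.proper ℝ V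
  rw [himage]
  refine IsCompact.image ?_ ?_
  · exact ((isCompact_sphere 0 1).prod (isCompact_sphere 0 1)).inter_right
      (isClosed_eq (by fun_prop) continuous_const)
  · fun_prop

end IsRadonForm

theorem mem_frontier_convexHull_of_apply_eq_one {S : Set V} {f : V →ₗ[ℝ] ℝ}
    (hf : ∀ s ∈ S, f s ≤ 1) {w : V} (hw : w ∈ convexHull ℝ S) (hfw : f w = 1) :
    w ∈ frontier (convexHull ℝ S) := by
  refine ⟨subset_closure hw, fun hint => ?_⟩
  have hle : convexHull ℝ S ⊆ {v | f v ≤ 1} :=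
    convexHull_min hf (convex_halfSpace_le f.isLinear 1)
  have hcont : Filter.Tendsto (fun t : ℝ => (1 + t) • w) (nhds 0) (nhds w) := by
    have h : Continuous fun t : ℝ => (1 + t) • w := by fun_prop
    simpa using h.tendsto 0
  have hev := hcont.eventually (mem_interior_iff_mem_nhds.mp hint)
  obtain ⟨ε, hε, hball⟩ := Metric.eventually_nhds_iff.mp hev
  have h := hle (hball (y := ε / 2) (by
    rw [Real.dist_eq, sub_zero, abs_of_pos (by positivity)]; linarith))
  simp only [Set.mem_ofPred_eq, map_smul, hfw, smul_eq_mul, mul_one] at h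
  linarith

/-- The equilateral triangle joining midpoints of alternate sides of the hexagon. -/
theorem exists_triangle_sine_le_of_isAffRegHexagon (hV : finrank ℝ V = 2)
    (h : IsAffRegHexagon V) :
    ∃ x y z : V, ‖x‖ = 1 ∧ ‖y‖ = 1 ∧ ‖z‖ = 1 ∧ x + y + z = 0 ∧ sine x y ≤ 3 / 4 := by
  obtain ⟨u, v, hli, -, -, hsphere⟩ := h
  let b := basisOfLinearIndependentOfCardEqFinrank hli (by simp [hV])
  have hb₀ : b 0 = u := by simp [b]
  have hb₁ : b 1 = v := by simp [b]
  have c₀u : b.coord 0 u = 1 := by rw [← hb₀]; simp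
  have c₀v : b.coord 0 v = 0 := by rw [← hb₁]; simp
  have c₁u : b.coord 1 u = 0 := by rw [← hb₀]; simp
  have c₁v : b.coord 1 v = 1 := by rw [← hb₁]; simp
  set S : Set V := {u, -u, v, -v, u + v, -(u + v)} with hS
  have unit : ∀ f : V →ₗ[ℝ] ℝ, (∀ s ∈ S, f s ≤ 1) → ∀ w ∈ convexHull ℝ S, f w = 1 → ‖w‖ = 1 := by
    intro f hf w hw hfw
    have hmem := mem_frontier_convexHull_of_apply_eq_one hf hw hfw
    rwa [← hsphere] at hmem
  have h₀ : ∀ s ∈ S, b.coord 0 s ≤ 1 := by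
    rintro s (rfl | rfl | rfl | rfl | rfl | rfl) <;>
      simp only [map_neg, map_add, c₀u, c₀v] <;> norm_num
  have h₁ : ∀ s ∈ S, b.coord 1 s ≤ 1 := by
    rintro s (rfl | rfl | rfl | rfl | rfl | rfl) <;>
      simp only [map_neg, map_add, c₁u, c₁v] <;> norm_num
  have h₂ : ∀ s ∈ S, (b.coord 1 - b.coord 0) s ≤ 1 := by
    rintro s (rfl | rfl | rfl | rfl | rfl | rfl) <;>
      simp only [LinearMap.sub_apply, map_neg, map_add, c₀u, c₀v, c₁u, c₁v] <;> norm_num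
  have midpoint_mem : ∀ {p q : V}, p ∈ S → q ∈ S →
      (1 / 2 : ℝ) • p + (1 / 2 : ℝ) • q ∈ convexHull ℝ S := fun hp hq =>
    convex_convexHull ℝ S (subset_convexHull ℝ S hp) (subset_convexHull ℝ S hq)
      (by norm_num) (by norm_num) (by norm_num)
  have hadd : ‖u + v‖ = 1 := unit _ h₀ _ (subset_convexHull ℝ S (by simp [hS]))
    (by simp only [map_add, c₀u, c₀v]; norm_num)
  have hx := unit _ h₀ _ (midpoint_mem (p := u) (q := u + v) (by simp [hS]) (by simp [hS]))
    (by simp only [map_add, map_smul, smul_eq_mul, c₀u, c₀v]; norm_num)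
  have hy := unit _ h₂ _ (midpoint_mem (p := v) (q := -u) (by simp [hS]) (by simp [hS]))
    (by simp only [LinearMap.sub_apply, map_add, map_neg, map_smul, smul_eq_mul, c₀u, c₀v, c₁u,
      c₁v]; norm_num)
  have hz := unit _ h₁ _ (midpoint_mem (p := v) (q := u + v) (by simp [hS]) (by simp [hS]))
    (by simp only [map_add, map_smul, smul_eq_mul, c₁u, c₁v]; norm_num)
  refine ⟨_, _, _, hx, hy, (norm_neg _).trans hz, by module, ?_⟩
  refine (ciInf_le ⟨0, Set.forall_mem_range.mpr fun t => norm_nonneg _⟩ (1 / 2 : ℝ)).trans_eq ?_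
  have e : (1 / 2 : ℝ) • u + (1 / 2 : ℝ) • (u + v) + (1 / 2 : ℝ) • ((1 / 2 : ℝ) • v +
      (1 / 2 : ℝ) • -u) = (3 / 4 : ℝ) • (u + v) := by module
  rw [e, norm_smul, hadd]
  norm_num

theorem ct_eq_three_quarters_iff (hV : finrank ℝ V = 2)
    (hRadon : ∀ x y : V, BOrth x y → BOrth y x) :
    sInf (triSines V) = 3 / 4 ↔ IsAffRegHexagon V := by
  have : FiniteDimensional ℝ V := Module.finite_of_finrank_eq_succ hV
  obtain ⟨ω, hω⟩ := exists_isRadonForm hV hRadon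
  constructor
  · intro h
    have hne : (triSines V).Nonempty := by
      by_contra hempty
      rw [Set.not_nonempty_iff_eq_empty.mp hempty, Real.sInf_empty] at h
      norm_num at h
    obtain ⟨x, y, z, hx, hy, hz, hxyz, hs⟩ := hω.isCompact_triSines.sInf_mem hne
    obtain ⟨u, v, hu, hv, hadd, huv⟩ := (hω.triangle_bound hx hy hz hxyz).2 (hs.symm.trans h)
    exact hω.isAffRegHexagon_of_apply_eq_one hu hv hadd huv
  · intro h
    obtain ⟨x, y, z, hx, hy, hz, hxyz, hs⟩ := exists_triangle_sine_le_of_isAffRegHexagon hV h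
    refine IsLeast.csInf_eq ⟨⟨x, y, z, hx, hy, hz, hxyz, ?_⟩, ?_⟩
    · exact (hω.triangle_bound hx hy hz hxyz).1.antisymm hs
    · rintro r ⟨x, y, z, hx, hy, hz, hxyz, rfl⟩
      exact (hω.triangle_bound hx hy hz hxyz).1
end

section
/- For the norm ‖·‖_{4n} on ℝ² whose unit circle is the regular 4n-gon inscribed in the Euclidean unit circle, D(‖·‖_{4n}) = 2cos(π/4n)/(1 + cos(π/4n)), where D = inf{inf_{t∈ℝ} ‖x + t y‖ : x, y unit vectors with ‖x+y‖ = ‖x−y‖}. In particular D(‖·‖_{4n}) → 1 as n → ∞. -/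
noncomputable def polyVert (n k : ℕ) : ℝ × ℝ :=
  (Real.cos ((2 * k + 1) * Real.pi / (4 * n)), Real.sin ((2 * k + 1) * Real.pi / (4 * n)))

noncomputable def nm (n : ℕ) (x : ℝ × ℝ) : ℝ :=
  gauge (convexHull ℝ (Set.range fun k : Fin (4 * n) => polyVert n k)) x

noncomputable def Dconst (n : ℕ) : ℝ :=
  sInf {r : ℝ | ∃ x y : ℝ × ℝ, nm n x = 1 ∧ nm n y = 1 ∧ nm n (x + y) = nm n (x - y) ∧
    r = ⨅ t : ℝ, nm n (x + t • y)}

/-- The rotation of the plane by a quarter turn. -/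
def quarterTurn : ℝ × ℝ →ₗ[ℝ] ℝ × ℝ where
  toFun z := (-z.2, z.1)
  map_add' x y := by ext <;> simp; ring
  map_smul' r x := by ext <;> simp

lemma quarterTurn_apply (z : ℝ × ℝ) : quarterTurn z = (-z.2, z.1) := rfl

lemma quarterTurn_quarterTurn (z : ℝ × ℝ) : quarterTurn (quarterTurn z) = -z := by
  ext <;> simp [quarterTurn_apply]

section Angles

variable {n : ℕ}

lemma pi_div_four_mul_pos (hn : 1 ≤ n) : 0 < Real.pi / (4 * n) := by
  have : (1 : ℝ) ≤ n := by exact_mod_cast hn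
  positivity

lemma pi_div_four_mul_le (hn : 1 ≤ n) : Real.pi / (4 * n) ≤ Real.pi / 4 := by
  have : (1 : ℝ) ≤ n := by exact_mod_cast hn
  apply div_le_div_of_nonneg_left Real.pi_pos.le (by norm_num) (by linarith)

lemma cos_pi_div_four_mul_pos (hn : 1 ≤ n) : 0 < Real.cos (Real.pi / (4 * n)) :=
  Real.cos_pos_of_mem_Ioo
    ⟨by linarith [pi_div_four_mul_pos hn, Real.pi_pos],
      by linarith [pi_div_four_mul_le hn, Real.pi_pos]⟩

lemma sin_pi_div_four_mul_pos (hn : 1 ≤ n) : 0 < Real.sin (Real.pi / (4 * n)) :=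
  Real.sin_pos_of_pos_of_lt_pi (pi_div_four_mul_pos hn)
    (by linarith [pi_div_four_mul_le hn, Real.pi_pos])

lemma polyVert_eq (n k : ℕ) :
    polyVert n k = (Real.cos ((2 * k + 1) * (Real.pi / (4 * n))),
      Real.sin ((2 * k + 1) * (Real.pi / (4 * n)))) := by
  simp only [polyVert, mul_div_assoc]

lemma polyVert_zero (n : ℕ) :
    polyVert n 0 = (Real.cos (Real.pi / (4 * n)), Real.sin (Real.pi / (4 * n))) := by
  simp [polyVert]

lemma polyVert_add_period (hn : 1 ≤ n) (k : ℕ) : polyVert n (k + 4 * n) = polyVert n k := by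
  have h0 : (n : ℝ) ≠ 0 := by positivity
  have h : (2 * ((k + 4 * n : ℕ) : ℝ) + 1) * (Real.pi / (4 * n))
      = (2 * k + 1) * (Real.pi / (4 * n)) + 2 * Real.pi := by
    push_cast; field_simp; ring
  rw [polyVert_eq, polyVert_eq, h, Real.cos_add_two_pi, Real.sin_add_two_pi]

lemma polyVert_mod (hn : 1 ≤ n) (k : ℕ) : polyVert n (k % (4 * n)) = polyVert n k := by
  have h : Function.Periodic (polyVert n) (4 * n) := polyVert_add_period hn
  exact h.map_mod_nat k

lemma polyVert_add_quarter (hn : 1 ≤ n) (k : ℕ) :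
    polyVert n (k + n) = quarterTurn (polyVert n k) := by
  have h0 : (n : ℝ) ≠ 0 := by positivity
  have h : (2 * ((k + n : ℕ) : ℝ) + 1) * (Real.pi / (4 * n))
      = (2 * k + 1) * (Real.pi / (4 * n)) + Real.pi / 2 := by
    push_cast; field_simp; ring
  rw [polyVert_eq, polyVert_eq, h, Real.cos_add_pi_div_two, Real.sin_add_pi_div_two]
  rfl

lemma polyVert_sq_add_sq (n k : ℕ) : (polyVert n k).1 ^ 2 + (polyVert n k).2 ^ 2 = 1 := by
  simp [polyVert]

lemma polyVert_succ (n k : ℕ) :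
    polyVert n (k + 1) = Real.cos (2 * (Real.pi / (4 * n))) • polyVert n k
      + Real.sin (2 * (Real.pi / (4 * n))) • quarterTurn (polyVert n k) := by
  have h : (2 * ((k + 1 : ℕ) : ℝ) + 1) * (Real.pi / (4 * n))
      = (2 * k + 1) * (Real.pi / (4 * n)) + 2 * (Real.pi / (4 * n)) := by
    push_cast; ring
  rw [polyVert_eq, polyVert_eq, h, Real.cos_add, Real.sin_add, quarterTurn_apply]
  ext <;> simp <;> ring

lemma polyVert_pred (hn : 1 ≤ n) (k : ℕ) :
    polyVert n (k + (4 * n - 1)) = Real.cos (2 * (Real.pi / (4 * n))) • polyVert n k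
      - Real.sin (2 * (Real.pi / (4 * n))) • quarterTurn (polyVert n k) := by
  have h0 : (n : ℝ) ≠ 0 := by positivity
  have h : (2 * ((k + (4 * n - 1) : ℕ) : ℝ) + 1) * (Real.pi / (4 * n))
      = (2 * k + 1) * (Real.pi / (4 * n)) - 2 * (Real.pi / (4 * n)) + 2 * Real.pi := by
    rw [Nat.cast_add, Nat.cast_sub (by omega)]
    push_cast; field_simp; ring
  rw [polyVert_eq, polyVert_eq, h, Real.cos_add_two_pi, Real.sin_add_two_pi, Real.cos_sub,
    Real.sin_sub, quarterTurn_apply]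
  ext <;> simp <;> ring

lemma polyVert_fst_le (hn : 1 ≤ n) (k : Fin (4 * n)) :
    (polyVert n k).1 ≤ Real.cos (Real.pi / (4 * n)) := by
  have hp := pi_div_four_mul_pos hn
  have hq := pi_div_four_mul_le hn
  have hpi := Real.pi_pos
  have h0 : (n : ℝ) ≠ 0 := by positivity
  have hk : ((k : ℕ) : ℝ) + 1 ≤ 4 * n := by exact_mod_cast k.2
  have hk0 : (0 : ℝ) ≤ (k : ℕ) := Nat.cast_nonneg _
  have hα : 4 * n * (Real.pi / (4 * n)) = Real.pi := by field_simp
  rw [polyVert_eq]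
  set α := Real.pi / (4 * n)
  change Real.cos ((2 * ((k : ℕ) : ℝ) + 1) * α) ≤ Real.cos α
  by_cases h : (2 * ((k : ℕ) : ℝ) + 1) * α ≤ Real.pi
  · exact Real.cos_le_cos_of_nonneg_of_le_pi hp.le h (by nlinarith)
  · rw [← Real.cos_two_pi_sub]
    exact Real.cos_le_cos_of_nonneg_of_le_pi hp.le (by linarith) (by nlinarith)

end Angles

section Norm

variable {n : ℕ}

lemma polyVert_mem_convexHull (hn : 1 ≤ n) (k : ℕ) :
    polyVert n k ∈ convexHull ℝ (Set.range fun k : Fin (4 * n) => polyVert n k) := by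
  apply subset_convexHull
  exact ⟨⟨k % (4 * n), Nat.mod_lt _ (by omega)⟩, polyVert_mod hn k⟩

lemma quarterTurn_mem_convexHull (hn : 1 ≤ n) {z : ℝ × ℝ}
    (hz : z ∈ convexHull ℝ (Set.range fun k : Fin (4 * n) => polyVert n k)) :
    quarterTurn z ∈ convexHull ℝ (Set.range fun k : Fin (4 * n) => polyVert n k) := by
  have hsub : convexHull ℝ (Set.range fun k : Fin (4 * n) => polyVert n k) ⊆
      quarterTurn ⁻¹' convexHull ℝ (Set.range fun k : Fin (4 * n) => polyVert n k) := by
    refine convexHull_min ?_ ((convex_convexHull ℝ _).linear_preimage quarterTurn)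
    rintro _ ⟨k, rfl⟩
    rw [Set.mem_preimage]
    rw [← polyVert_add_quarter hn]
    exact polyVert_mem_convexHull hn _
  exact hsub hz

/-- A convex set containing `±u` and `±w` contains the parallelogram they span. -/
lemma Convex.smul_add_smul_mem_of_neg_mem {E : Type*} [AddCommGroup E] [Module ℝ E] {K : Set E}
    (hK : Convex ℝ K) {u w : E} (hu : u ∈ K) (hu' : -u ∈ K) (hw : w ∈ K) (hw' : -w ∈ K)
    {p q : ℝ} (h : |p| + |q| ≤ 1) : p • u + q • w ∈ K := by
  have hp := abs_le.1 (le_refl |p|)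
  have hq := abs_le.1 (le_refl |q|)
  have := hK.sum_mem (t := Finset.univ)
    (w := ![(1 - |q| + p) / 2, (1 - |q| - p) / 2, (|q| + q) / 2, (|q| - q) / 2])
    (z := ![u, -u, w, -w])
    (by intro i _; fin_cases i <;> simp <;> linarith)
    (by simp [Fin.sum_univ_four]; ring)
    (by intro i _; fin_cases i <;> simpa)
  convert this using 1
  simp [Fin.sum_univ_four]
  module

lemma absorbent_convexHull_polyVert (hn : 1 ≤ n) :
    Absorbent ℝ (convexHull ℝ (Set.range fun k : Fin (4 * n) => polyVert n k)) := by
  apply absorbent_nhds_zero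
  set u := polyVert n 0
  have hu1 : u.1 ^ 2 + u.2 ^ 2 = 1 := polyVert_sq_add_sq n 0
  have hu := polyVert_mem_convexHull hn 0
  have hw := quarterTurn_mem_convexHull hn hu
  have hu' := quarterTurn_mem_convexHull hn hw
  have hw' := quarterTurn_mem_convexHull hn hu'
  rw [quarterTurn_quarterTurn] at hu' hw'
  have hopen : IsOpen {z : ℝ × ℝ | |z.1 * u.1 + z.2 * u.2| + |z.2 * u.1 - z.1 * u.2| < 1} :=
    isOpen_lt (by fun_prop) continuous_const
  refine Filter.mem_of_superset (hopen.mem_nhds (by simp)) ?_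
  intro z hz
  have := (convex_convexHull ℝ _).smul_add_smul_mem_of_neg_mem hu hu' hw hw' (le_of_lt hz)
  convert this using 1
  change z = _ • u + _ • quarterTurn u
  rw [quarterTurn_apply]
  ext <;> simp
  · linear_combination (-z.1) * hu1
  · linear_combination (-z.2) * hu1

lemma nm_add_le (hn : 1 ≤ n) (x y : ℝ × ℝ) : nm n (x + y) ≤ nm n x + nm n y :=
  gauge_add_le (convex_convexHull ℝ _) (absorbent_convexHull_polyVert hn) x y

lemma nm_nonneg (n : ℕ) (x : ℝ × ℝ) : 0 ≤ nm n x := gauge_nonneg x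

lemma nm_zero (n : ℕ) : nm n 0 = 0 := gauge_zero

lemma nm_neg (hn : 1 ≤ n) (x : ℝ × ℝ) : nm n (-x) = nm n x := by
  refine gauge_neg (fun z hz => ?_) x
  rw [← quarterTurn_quarterTurn]
  exact quarterTurn_mem_convexHull hn (quarterTurn_mem_convexHull hn hz)

lemma nm_smul (hn : 1 ≤ n) (r : ℝ) (x : ℝ × ℝ) : nm n (r • x) = |r| * nm n x := by
  have key : ∀ s : ℝ, 0 ≤ s → ∀ z, nm n (s • z) = s * nm n z :=
    fun s hs z => gauge_smul_of_nonneg hs z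
  rcases le_total 0 r with h | h
  · rw [abs_of_nonneg h, key r h]
  · rw [abs_of_nonpos h, ← key (-r) (by linarith), neg_smul, nm_neg hn]

lemma nm_quarterTurn (hn : 1 ≤ n) (x : ℝ × ℝ) : nm n (quarterTurn x) = nm n x := by
  have key : ∀ z, nm n (quarterTurn z) ≤ nm n z := by
    intro z
    unfold nm
    rw [gauge_def', gauge_def']
    refine csInf_le_csInf ⟨0, fun r hr => hr.1.le⟩ ?_ ?_
    · obtain ⟨r, hr, hz⟩ := (absorbent_convexHull_polyVert hn).gauge_set_nonempty (x := z)
      exact ⟨r, hr, (Set.mem_smul_set_iff_inv_smul_mem₀ (ne_of_gt hr) _ _).1 hz⟩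
    · rintro r ⟨hr, hz⟩
      refine ⟨hr, ?_⟩
      rw [← map_smul]
      exact quarterTurn_mem_convexHull hn hz
  refine le_antisymm (key x) ?_
  calc nm n x = nm n (quarterTurn (quarterTurn x)) := by
        rw [quarterTurn_quarterTurn, nm_neg hn]
    _ ≤ _ := key _

lemma nm_polyVert_le_one (hn : 1 ≤ n) (k : ℕ) : nm n (polyVert n k) ≤ 1 :=
  gauge_le_one_of_mem (polyVert_mem_convexHull hn k)

/-- A linear functional bounded by `H` on the vertices is bounded by `H` times the norm. -/
lemma inner_le_mul_nm (hn : 1 ≤ n) {a b H : ℝ}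
    (h : ∀ k : Fin (4 * n), a * (polyVert n k).1 + b * (polyVert n k).2 ≤ H) (z : ℝ × ℝ) :
    a * z.1 + b * z.2 ≤ H * nm n z := by
  let f : ℝ × ℝ →ₗ[ℝ] ℝ := a • LinearMap.fst ℝ ℝ ℝ + b • LinearMap.snd ℝ ℝ ℝ
  have hf : ∀ w, f w = a * w.1 + b * w.2 := fun w => by simp [f]
  have hsub : convexHull ℝ (Set.range fun k : Fin (4 * n) => polyVert n k) ⊆ {w | f w ≤ H} := by
    refine convexHull_min ?_ (convex_halfSpace_le f.isLinear H)
    rintro _ ⟨k, rfl⟩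
    exact (hf _).trans_le (h k)
  have hscale : ∀ r, 0 < r → r⁻¹ • z ∈
      convexHull ℝ (Set.range fun k : Fin (4 * n) => polyVert n k) → f z ≤ H * r := by
    intro r hr hz
    have := hsub hz
    simp only [Set.mem_ofPred_eq, map_smul, smul_eq_mul] at this
    rwa [inv_mul_le_iff₀ hr, mul_comm] at this
  have hmem : 0 ≤ H := by
    have := hsub (show (0 : ℝ × ℝ) ∈ _ from (absorbent_convexHull_polyVert hn).zero_mem)
    simpa using this
  rw [← hf]
  obtain ⟨r, hr, hz⟩ := (absorbent_convexHull_polyVert hn).gauge_set_nonempty (x := z)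
  rw [Set.mem_smul_set_iff_inv_smul_mem₀ (ne_of_gt hr)] at hz
  rcases hmem.eq_or_lt with h0 | h0
  · simpa [← h0] using hscale r hr hz
  · rw [mul_comm, ← div_le_iff₀ h0]
    unfold nm
    rw [gauge_def']
    refine le_csInf ⟨r, hr, hz⟩ ?_
    rintro s ⟨hs, hsz⟩
    rw [div_le_iff₀ h0, mul_comm]
    exact hscale s hs hsz

end Norm

section Isosceles

variable {n : ℕ}

lemma inner_nonpos_of_nm_add_eq_nm_sub (hn : 1 ≤ n) {x y : ℝ × ℝ} (hx : nm n x = 1)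
    (hy : nm n y = 1) (h : nm n (x + y) = nm n (x - y))
    (hle : y.1 ^ 2 + y.2 ^ 2 ≤ x.1 ^ 2 + x.2 ^ 2) : x.1 * y.1 + x.2 * y.2 ≤ 0 := by
  set A := x.1 * y.1 + x.2 * y.2 with hA
  set B := x.1 * y.2 - x.2 * y.1 with hB
  set P := x.1 ^ 2 + x.2 ^ 2 with hP
  set Q := y.1 ^ 2 + y.2 ^ 2 with hQ
  have hid : A ^ 2 + B ^ 2 = P * Q := by rw [hA, hB, hP, hQ]; ring
  by_contra! hA0
  have hm : 0 < nm n (x + y) := by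
    have h1 := nm_add_le hn (x + y) (x - y)
    rw [show x + y + (x - y) = (2 : ℝ) • x by module, nm_smul hn, hx, ← h] at h1
    norm_num at h1
    linarith
  have hPAB : P ≤ A + |B| := by
    have h1 := nm_add_le hn (A • x) (B • quarterTurn x)
    have h2 : A • x + B • quarterTurn x = P • y := by
      rw [quarterTurn_apply]
      ext <;> simp [hA, hB, hP] <;> ring
    rw [h2, nm_smul hn, nm_smul hn, nm_smul hn, nm_quarterTurn hn, hx, hy,
      abs_of_pos hA0, abs_of_nonneg (by positivity : 0 ≤ P)] at h1
    linarith
  have hQAB : Q + A ≤ |B| := by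
    have h1 := nm_add_le hn ((2 * B) • (x + y)) ((P - Q) • quarterTurn (x + y))
    have h2 : (2 * B) • (x + y) + (P - Q) • quarterTurn (x + y)
        = (P + Q + 2 * A) • quarterTurn (x - y) := by
      rw [quarterTurn_apply, quarterTurn_apply]
      ext <;> simp [hA, hB, hP, hQ] <;> ring
    have hQ0 : 0 ≤ Q := by positivity
    have hP0 : 0 ≤ P := by positivity
    rw [h2, nm_smul hn, nm_smul hn, nm_smul hn, nm_quarterTurn hn, nm_quarterTurn hn, ← h,
      abs_of_nonneg (by linarith : 0 ≤ P - Q), abs_of_nonneg (by linarith : 0 ≤ P + Q + 2 * A),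
      ← add_mul, abs_mul, abs_two] at h1
    have := le_of_mul_le_mul_right h1 hm
    linarith
  have hQ0 : 0 ≤ Q := by positivity
  have h3 : P * Q ≤ (A + |B|) * (|B| - A) :=
    mul_le_mul hPAB (by linarith) hQ0 (by linarith [abs_nonneg B])
  nlinarith [sq_abs B]

/-- Isosceles orthogonal unit vectors are Euclidean orthogonal. -/
lemma inner_eq_zero_of_nm_add_eq_nm_sub (hn : 1 ≤ n) {x y : ℝ × ℝ} (hx : nm n x = 1)
    (hy : nm n y = 1) (h : nm n (x + y) = nm n (x - y)) : x.1 * y.1 + x.2 * y.2 = 0 := by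
  have hx' : nm n (-x) = 1 := by rw [nm_neg hn, hx]
  have hy' : nm n (-y) = 1 := by rw [nm_neg hn, hy]
  have h1 : nm n (x + -y) = nm n (x - -y) := by rw [sub_neg_eq_add, ← sub_eq_add_neg, h]
  have h2 : nm n (y + x) = nm n (y - x) := by rw [add_comm, h, ← nm_neg hn, neg_sub]
  have h3 : nm n (y + -x) = nm n (y - -x) := by rw [sub_neg_eq_add, ← sub_eq_add_neg, h2]
  rcases le_total (y.1 ^ 2 + y.2 ^ 2) (x.1 ^ 2 + x.2 ^ 2) with hle | hle
  · have e1 := inner_nonpos_of_nm_add_eq_nm_sub hn hx hy h hle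
    have e2 := inner_nonpos_of_nm_add_eq_nm_sub hn hx hy' h1 (by simpa using hle)
    simp at e2
    linarith
  · have e1 := inner_nonpos_of_nm_add_eq_nm_sub hn hy hx h2 hle
    have e2 := inner_nonpos_of_nm_add_eq_nm_sub hn hy hx' h3 (by simpa using hle)
    simp at e2
    linarith

/-- A vector at height `H` and offset `s` from a vertex lying in the adjacent sector. -/
lemma nm_le_of_mem_sector (hn : 1 ≤ n) {u w : ℝ × ℝ} (hu : nm n u ≤ 1) {H s : ℝ} (hs : 0 ≤ s)
    (hle : H * Real.cos (2 * (Real.pi / (4 * n))) + s * Real.sin (2 * (Real.pi / (4 * n))) ≤ H)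
    (hv : nm n (Real.cos (2 * (Real.pi / (4 * n))) • u
      + Real.sin (2 * (Real.pi / (4 * n))) • w) ≤ 1) :
    Real.cos (Real.pi / (4 * n)) * nm n (H • u + s • w)
      ≤ Real.cos (Real.pi / (4 * n)) * H + s * Real.sin (Real.pi / (4 * n)) := by
  have hc := cos_pi_div_four_mul_pos hn
  have hσ := sin_pi_div_four_mul_pos hn
  have hcs := Real.sin_sq_add_cos_sq (Real.pi / (4 * n))
  rw [Real.cos_two_mul, Real.sin_two_mul] at hle hv
  set c := Real.cos (Real.pi / (4 * n))
  set σ := Real.sin (Real.pi / (4 * n))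
  have hHs : s * c ≤ H * σ := by
    have : (s * c) * (2 * σ) ≤ (H * σ) * (2 * σ) := by
      linear_combination hle - 2 * H * hcs
    exact le_of_mul_le_mul_right this (by positivity)
  set q := s / (2 * σ * c) with hq
  have hq0 : 0 ≤ q := by positivity
  have hqs : q * (2 * σ * c) = s := by rw [hq]; field_simp
  have hp0 : 0 ≤ H - q * (2 * c ^ 2 - 1) := by
    have e1 : 2 * q * c ^ 2 ≤ H := by
      have : (2 * q * c ^ 2) * σ ≤ H * σ := by rw [← hqs] at hHs; linarith
      exact le_of_mul_le_mul_right this hσ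
    linarith
  have hdec : H • u + s • w = (H - q * (2 * c ^ 2 - 1)) • u
      + q • ((2 * c ^ 2 - 1) • u + (2 * σ * c) • w) := by
    rw [← hqs]; module
  have h1 := nm_add_le hn ((H - q * (2 * c ^ 2 - 1)) • u)
    (q • ((2 * c ^ 2 - 1) • u + (2 * σ * c) • w))
  rw [← hdec, nm_smul hn, nm_smul hn, abs_of_nonneg hp0, abs_of_nonneg hq0] at h1
  have h2 := mul_le_mul_of_nonneg_left hu hp0
  have h3 := mul_le_mul_of_nonneg_left hv hq0
  have h4 : nm n (H • u + s • w) ≤ H + q * (2 * σ ^ 2) := by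
    calc _ ≤ H - q * (2 * c ^ 2 - 1) + q := by linarith
      _ = _ := by linear_combination (-2 * q) * hcs
  calc c * nm n (H • u + s • w) ≤ c * (H + q * (2 * σ ^ 2)) :=
        mul_le_mul_of_nonneg_left h4 hc.le
    _ = _ := by rw [← hqs]; ring

/-- The best vertex functional in the direction `x` controls the Euclidean length of `x`. -/
lemma exists_vertex_bound (hn : 1 ≤ n) (x : ℝ × ℝ) (hx : nm n x = 1) :
    ∃ H : ℝ, 0 < H ∧ (∀ k : Fin (4 * n), x.1 * (polyVert n k).1 + x.2 * (polyVert n k).2 ≤ H) ∧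
      2 * Real.cos (Real.pi / (4 * n)) * H ≤
        (1 + Real.cos (Real.pi / (4 * n))) * (x.1 ^ 2 + x.2 ^ 2) := by
  have : Nonempty (Fin (4 * n)) := ⟨⟨0, by omega⟩⟩
  obtain ⟨j, hj⟩ := Finite.exists_max
    fun k : Fin (4 * n) => x.1 * (polyVert n k).1 + x.2 * (polyVert n k).2
  have hmax : ∀ k : ℕ, x.1 * (polyVert n k).1 + x.2 * (polyVert n k).2 ≤
      x.1 * (polyVert n j).1 + x.2 * (polyVert n j).2 := by
    intro k
    rw [← polyVert_mod hn k]
    exact hj ⟨k % (4 * n), Nat.mod_lt _ (by omega)⟩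
  have hu := nm_polyVert_le_one hn j
  have hsucc := hmax (j + 1)
  have hpred := hmax (j + (4 * n - 1))
  have hsucc' := nm_polyVert_le_one hn (j + 1)
  have hpred' := nm_polyVert_le_one hn (j + (4 * n - 1))
  have hsq := polyVert_sq_add_sq n j
  rw [polyVert_succ] at hsucc hsucc'
  rw [polyVert_pred hn] at hpred hpred'
  set u := polyVert n j
  set H := x.1 * u.1 + x.2 * u.2 with hH
  set s := x.2 * u.1 - x.1 * u.2 with hs
  have hnorm : x.1 ^ 2 + x.2 ^ 2 = H ^ 2 + s ^ 2 := by
    rw [hH, hs]; linear_combination (-(x.1 ^ 2 + x.2 ^ 2)) * hsq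
  have hdec : x = H • u + s • quarterTurn u := by
    rw [quarterTurn_apply]
    ext <;> simp [hH, hs]
    · linear_combination (-x.1) * hsq
    · linear_combination (-x.2) * hsq
  simp only [quarterTurn_apply, Prod.fst_add, Prod.snd_add, Prod.fst_sub, Prod.snd_sub,
    Prod.smul_fst, Prod.smul_snd, smul_eq_mul] at hsucc hpred
  have hsuccH : H * Real.cos (2 * (Real.pi / (4 * n)))
      + s * Real.sin (2 * (Real.pi / (4 * n))) ≤ H := by
    linear_combination hsucc + Real.cos (2 * (Real.pi / (4 * n))) * hH
      + Real.sin (2 * (Real.pi / (4 * n))) * hs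
  have hpredH : H * Real.cos (2 * (Real.pi / (4 * n)))
      + -s * Real.sin (2 * (Real.pi / (4 * n))) ≤ H := by
    linear_combination hpred + Real.cos (2 * (Real.pi / (4 * n))) * hH
      - Real.sin (2 * (Real.pi / (4 * n))) * hs
  have hbound : Real.cos (Real.pi / (4 * n)) ≤
      Real.cos (Real.pi / (4 * n)) * H + |s| * Real.sin (Real.pi / (4 * n)) := by
    rcases le_total 0 s with h0 | h0
    · have := nm_le_of_mem_sector hn hu h0 hsuccH hsucc'
      rwa [← hdec, hx, mul_one, ← abs_of_nonneg h0] at this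
    · have := nm_le_of_mem_sector hn (w := -quarterTurn u) hu (neg_nonneg.2 h0)
        hpredH (by rwa [smul_neg, ← sub_eq_add_neg])
      rwa [neg_smul_neg, ← hdec, hx, mul_one, ← abs_of_nonpos h0] at this
  have hc := cos_pi_div_four_mul_pos hn
  have hσ := sin_pi_div_four_mul_pos hn
  have hcs := Real.sin_sq_add_cos_sq (Real.pi / (4 * n))
  have hc1 := Real.cos_le_one (Real.pi / (4 * n))
  have hcos2 := Real.cos_two_mul (Real.pi / (4 * n))
  have hH0 : 0 ≤ H := by
    have : 0 ≤ H * (2 * Real.sin (Real.pi / (4 * n)) ^ 2) := by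
      rw [hcos2] at hsuccH hpredH
      linear_combination (hsuccH + hpredH) / 2 - 2 * H * hcs
    exact nonneg_of_mul_nonneg_left this (by positivity)
  have hfun := inner_le_mul_nm hn hj x
  have hHx : x.1 ^ 2 + x.2 ^ 2 ≤ H := by
    change _ ≤ H * _ at hfun
    rw [hx] at hfun
    linarith
  refine ⟨H, ?_, hj, ?_⟩
  · rcases hH0.eq_or_lt with h | h
    · exfalso
      have : s = 0 := by
        rw [hnorm] at hHx
        have : s ^ 2 ≤ 0 := by nlinarith
        nlinarith
      rw [← h, this] at hdec
      simp only [zero_smul, add_zero] at hdec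
      rw [hdec, nm_zero] at hx
      norm_num at hx
    · exact h
  · rw [hnorm]
    set c := Real.cos (Real.pi / (4 * n))
    set σ := Real.sin (Real.pi / (4 * n))
    have h1 : 2 * (H * |s|) * σ ≤ (1 - c) * H ^ 2 + (1 + c) * s ^ 2 := by
      have h2 : 0 ≤ (σ * H - (1 + c) * |s|) ^ 2 := sq_nonneg _
      have h3 : (1 + c) * (2 * (H * |s|) * σ) ≤
          (1 + c) * ((1 - c) * H ^ 2 + (1 + c) * s ^ 2) := by
        have e : (σ * H - (1 + c) * |s|) ^ 2 = (1 + c) * ((1 - c) * H ^ 2 + (1 + c) * s ^ 2)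
            - (1 + c) * (2 * (H * |s|) * σ) := by
          linear_combination H ^ 2 * hcs + (1 + c) ^ 2 * sq_abs s
        linarith
      exact le_of_mul_le_mul_left h3 (by linarith)
    have h4 := mul_le_mul_of_nonneg_left hbound (by linarith : 0 ≤ 2 * H)
    linarith

end Isosceles

lemma le_iInf_nm {n : ℕ} (hn : 1 ≤ n) {x y : ℝ × ℝ} (hx : nm n x = 1) (hy : nm n y = 1)
    (h : nm n (x + y) = nm n (x - y)) :
    2 * Real.cos (Real.pi / (4 * n)) / (1 + Real.cos (Real.pi / (4 * n))) ≤
      ⨅ t : ℝ, nm n (x + t • y) := by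
  have hc := cos_pi_div_four_mul_pos hn
  refine le_ciInf fun t => ?_
  obtain ⟨H, hH, hk, hle⟩ := exists_vertex_bound hn x hx
  have hA := inner_eq_zero_of_nm_add_eq_nm_sub hn hx hy h
  have h1 := inner_le_mul_nm hn hk (x + t • y)
  have h2 : x.1 * (x + t • y).1 + x.2 * (x + t • y).2 = x.1 ^ 2 + x.2 ^ 2 := by
    simp only [Prod.fst_add, Prod.snd_add, Prod.smul_fst, Prod.smul_snd, smul_eq_mul]
    linear_combination t * hA
  rw [h2] at h1
  rw [div_le_iff₀ (by linarith)]
  refine le_of_mul_le_mul_right ?_ hH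
  calc _ ≤ _ := hle
    _ ≤ _ := mul_le_mul_of_nonneg_left h1 (by linarith)
    _ = _ := by ring

/-- The unit vector on the ray bisecting the angle between a vertex and an adjacent edge normal
realises the infimum. -/
lemma exists_iInf_nm_eq {n : ℕ} (hn : 1 ≤ n) :
    ∃ x y : ℝ × ℝ, nm n x = 1 ∧ nm n y = 1 ∧ nm n (x + y) = nm n (x - y) ∧
      2 * Real.cos (Real.pi / (4 * n)) / (1 + Real.cos (Real.pi / (4 * n))) =
        ⨅ t : ℝ, nm n (x + t • y) := by
  have hc := cos_pi_div_four_mul_pos hn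
  have hcs := Real.sin_sq_add_cos_sq (Real.pi / (4 * n))
  have hfst := inner_le_mul_nm hn (a := 1) (b := 0)
    (fun k => by simpa using polyVert_fst_le hn k)
  have hv0 := nm_polyVert_le_one hn 0
  have hv1 := nm_polyVert_le_one hn (0 + (4 * n - 1))
  rw [polyVert_pred hn, quarterTurn_apply, Real.cos_two_mul, Real.sin_two_mul] at hv1
  rw [polyVert_zero] at hv0 hv1
  set c := Real.cos (Real.pi / (4 * n))
  set σ := Real.sin (Real.pi / (4 * n))
  have hv1' : nm n (c, -σ) ≤ 1 := by
    convert hv1 using 2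
    ext <;> simp
    · linear_combination (-2 * c) * hcs
    · ring
  have hc1 : 0 < 1 + c := by linarith
  set x : ℝ × ℝ := (c, c * σ / (1 + c)) with hxdef
  have hx : nm n x = 1 := by
    apply le_antisymm
    · have h1 := nm_add_le hn (((1 + 2 * c) / (2 * (1 + c))) • ((c, σ) : ℝ × ℝ))
        ((1 / (2 * (1 + c))) • ((c, -σ) : ℝ × ℝ))
      have h2 : ((1 + 2 * c) / (2 * (1 + c))) • ((c, σ) : ℝ × ℝ)
          + (1 / (2 * (1 + c))) • ((c, -σ) : ℝ × ℝ) = x := by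
        ext <;> simp [hxdef] <;> field_simp <;> ring
      have e1 : 0 ≤ (1 + 2 * c) / (2 * (1 + c)) := by positivity
      have e2 : 0 ≤ 1 / (2 * (1 + c)) := by positivity
      have e3 : (1 + 2 * c) / (2 * (1 + c)) + 1 / (2 * (1 + c)) = 1 := by field_simp; ring
      rw [h2, nm_smul hn, nm_smul hn, abs_of_nonneg e1, abs_of_nonneg e2] at h1
      linarith [mul_le_mul_of_nonneg_left hv0 e1, mul_le_mul_of_nonneg_left hv1' e2]
    · have h1 := hfst x
      simp only [hxdef, one_mul, zero_mul, add_zero] at h1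
      exact le_of_mul_le_mul_left (by rwa [mul_one]) hc
  have hy : nm n (quarterTurn x) = 1 := by rw [nm_quarterTurn hn, hx]
  have hxy : nm n (x + quarterTurn x) = nm n (x - quarterTurn x) := by
    rw [← nm_quarterTurn hn (x - quarterTurn x), map_sub, quarterTurn_quarterTurn, sub_neg_eq_add,
      add_comm]
  refine ⟨x, quarterTurn x, hx, hy, hxy, le_antisymm (le_iInf_nm hn hx hy hxy) ?_⟩
  refine (ciInf_le ⟨0, ?_⟩ (σ / (1 + c))).trans ?_
  · rintro _ ⟨t, rfl⟩
    exact nm_nonneg _ _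
  · have h2 : x + (σ / (1 + c)) • quarterTurn x = (2 * c / (1 + c)) • ((c, σ) : ℝ × ℝ) := by
      rw [quarterTurn_apply]
      ext <;> simp [hxdef] <;> field_simp
      · linear_combination (-1) * hcs
      · ring
    have h0 : 0 ≤ 2 * c / (1 + c) := by positivity
    rw [h2, nm_smul hn, abs_of_nonneg h0]
    exact mul_le_of_le_one_right h0 hv0

lemma Dconst_eq {n : ℕ} (hn : 1 ≤ n) :
    Dconst n = 2 * Real.cos (Real.pi / (4 * n)) / (1 + Real.cos (Real.pi / (4 * n))) := by
  refine IsLeast.csInf_eq ⟨exists_iInf_nm_eq hn, ?_⟩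
  rintro _ ⟨x, y, hx, hy, h, rfl⟩
  exact le_iInf_nm hn hx hy h

theorem Dconst_regular_4n_gon :
    (∀ n : ℕ, 1 ≤ n →
      Dconst n = 2 * Real.cos (Real.pi / (4 * n)) / (1 + Real.cos (Real.pi / (4 * n)))) ∧
    Filter.Tendsto Dconst Filter.atTop (nhds 1) := by
  refine ⟨fun n hn => Dconst_eq hn, ?_⟩
  have hangle : Filter.Tendsto (fun n : ℕ => Real.pi / (4 * (n : ℝ))) Filter.atTop (nhds 0) :=
    Filter.Tendsto.const_div_atTop
      (tendsto_natCast_atTop_atTop.const_mul_atTop (by norm_num)) _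
  have hcos := (Real.continuous_cos.tendsto 0).comp hangle
  rw [Real.cos_zero] at hcos
  have hlim := (hcos.const_mul 2).div (hcos.const_add 1) (by norm_num)
  norm_num at hlim
  refine hlim.congr' ?_
  filter_upwards [Filter.eventually_ge_atTop 1] with n hn
  exact (Dconst_eq hn).symm
end
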